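/- Let A and B be homogeneous sets with α_A(r) ∼ α_A(x*,r) and α_B(r) ∼ α_B(y*,r) for some x* ∈ A and y* ∈ B. Suppose that for some r₀ < 1, the supremum over all r, r' with r' < r₀·r < r < r₀ of |(α_A(r) log r − α_A(r') log r')/(α_B(r) log r − α_B(r') log r')| is strictly less than 1. Then for every ε > 0 there exists a homogeneous subset A_ε ⊂ A such that d_H(A_ε, A) < ε, χ(A_ε, A) < ε, and A_ε can be bilipschitz embedded into B. -/

import Mathlib

open scoped ENNReal

noncomputable section

open Filter MeasureTheory

/-- A compact set `A` is *homogeneous* with respect to the Borel probability measure `μ`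
supported on `A` and constants `lam ≥ 1`, `kappa ∈ (0,1)`, `1 < del ≤ Del`. -/
structure IsHomog {X : Type*} [MetricSpace X] [MeasurableSpace X]
    (A : Set X) (μ : Measure X) (lam kappa del Del : ℝ) : Prop where
  compact : IsCompact A
  diam_pos : 0 < Metric.diam A
  prob : IsProbabilityMeasure μ
  supp_null : μ Aᶜ = 0
  supp_pos : ∀ x ∈ A, ∀ r : ℝ, 0 < r → 0 < μ (Metric.closedBall x r)
  one_le_lam : 1 ≤ lam
  ratio_le : ∀ x₁ ∈ A, ∀ x₂ ∈ A, ∀ r : ℝ, 0 < r → r ≤ Metric.diam A →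
    (μ (Metric.closedBall x₁ r)).toReal ≤ lam * (μ (Metric.closedBall x₂ r)).toReal
  kappa_pos : 0 < kappa
  kappa_lt_one : kappa < 1
  one_lt_del : 1 < del
  del_le_Del : del ≤ Del
  scale_lower : ∀ x ∈ A, ∀ r : ℝ, 0 < r → r ≤ Metric.diam A →
    del * (μ (Metric.closedBall x (kappa * r))).toReal ≤ (μ (Metric.closedBall x r)).toReal
  scale_upper : ∀ x ∈ A, ∀ r : ℝ, 0 < r → r ≤ Metric.diam A →
    (μ (Metric.closedBall x r)).toReal ≤ Del * (μ (Metric.closedBall x (kappa * r))).toReal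

/-- `alphaPt μ x r = log μ(B(x,r)) / log r`. -/
def alphaPt {X : Type*} [MetricSpace X] [MeasurableSpace X]
    (μ : Measure X) (x : X) (r : ℝ) : ℝ :=
  Real.log (μ (Metric.closedBall x r)).toReal / Real.log r

/-- `g ∼ h` : `|h r - g r| = O(1/|log r|)` as `r → 0⁺`. -/
def EquivNearZero (g h : ℝ → ℝ) : Prop :=
  ∃ C : ℝ, 0 < C ∧ ∃ δ : ℝ, 0 < δ ∧ ∀ r : ℝ, 0 < r → r < δ → |h r - g r| ≤ C / |Real.log r|

/-- `g` is a representative of the equivalence class `[α_A(x,·)]` of the homogeneous set `A`. -/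
def IsAlphaRep {X : Type*} [MetricSpace X] [MeasurableSpace X]
    (A : Set X) (μ : Measure X) (g : ℝ → ℝ) : Prop :=
  ∃ x ∈ A, EquivNearZero g (fun r => alphaPt μ x r)

/-- `χ(A,B)` computed from representatives `g` of `[α_A]` and `h` of `[α_B]`. -/
def chiFun (g h : ℝ → ℝ) : ℝ :=
  Filter.limsup (fun r => |Real.log (g r / h r)|) (nhdsWithin (0 : ℝ) (Set.Ioi 0))

/-- `N(A,r)`: the smallest number of closed balls of radius `r` needed to cover `A`. -/
def coverNum {X : Type*} [MetricSpace X] (A : Set X) (r : ℝ) : ℕ :=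
  sInf {m : ℕ | ∃ s : Finset X, s.card = m ∧ A ⊆ ⋃ x ∈ s, Metric.closedBall x r}

/-- Lower box-counting dimension. -/
def lowerBoxDim {X : Type*} [MetricSpace X] (A : Set X) : ℝ :=
  Filter.liminf (fun r : ℝ => Real.log (coverNum A r : ℝ) / (-Real.log r))
    (nhdsWithin (0 : ℝ) (Set.Ioi 0))

/-- Upper box-counting dimension. -/
def upperBoxDim {X : Type*} [MetricSpace X] (A : Set X) : ℝ :=
  Filter.limsup (fun r : ℝ => Real.log (coverNum A r : ℝ) / (-Real.log r))
    (nhdsWithin (0 : ℝ) (Set.Ioi 0))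

/-- Radius-based packing premeasure. -/
def packPre {X : Type*} [MetricSpace X] (A : Set X) (s : ℝ) : ℝ≥0∞ :=
  ⨅ (δ : ℝ) (_ : 0 < δ),
    ⨆ (m : ℕ) (x : Fin m → X) (ρ : Fin m → ℝ) (_ : ∀ i, x i ∈ A)
      (_ : ∀ i, 0 < ρ i ∧ ρ i ≤ δ)
      (_ : ∀ i j, i ≠ j →
        Disjoint (Metric.closedBall (x i) (ρ i)) (Metric.closedBall (x j) (ρ j))),
      ∑ i, ENNReal.ofReal (ρ i ^ s)

/-- Radius-based packing measure. -/
def packMeasure {X : Type*} [MetricSpace X] (A : Set X) (s : ℝ) : ℝ≥0∞ :=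
  ⨅ (F : ℕ → Set X) (_ : A ⊆ ⋃ m, F m), ∑' m, packPre (F m) s

/-- Radius-based packing dimension. -/
def packDim {X : Type*} [MetricSpace X] (A : Set X) : ℝ :=
  sInf {s : ℝ | 0 ≤ s ∧ packMeasure A s = 0}

/-- Distance between two sets, valued in `ℝ≥0∞`. -/
def setDistE {X : Type*} [MetricSpace X] (E F : Set X) : ℝ≥0∞ :=
  ⨅ (a : X) (_ : a ∈ E) (b : X) (_ : b ∈ F), edist a b

/-- Uniformly disconnected set. -/
def UnifDisconn {X : Type*} [MetricSpace X] (A : Set X) : Prop :=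
  ∃ C : ℝ, 1 < C ∧ ∃ rstar : ℝ, 0 < rstar ∧ ∀ x ∈ A, ∀ r : ℝ, 0 < r → r < rstar →
    ∃ E : Set X, E ⊆ A ∧ A ∩ Metric.closedBall x r ⊆ E ∧
      E ⊆ Metric.closedBall x (C * r) ∧ ENNReal.ofReal r < setDistE E (A \ E)

/-- `A` can be bilipschitz embedded into `B`. -/
def BilipEmbed {X Y : Type*} [MetricSpace X] [MetricSpace Y] (A : Set X) (B : Set Y) : Prop :=
  ∃ (f : X → Y) (L : ℝ), 1 ≤ L ∧ Set.MapsTo f A B ∧ Set.InjOn f A ∧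
    ∀ x₁ ∈ A, ∀ x₂ ∈ A,
      dist x₁ x₂ / L ≤ dist (f x₁) (f x₂) ∧ dist (f x₁) (f x₂) ≤ L * dist x₁ x₂

/-- `A` and `B` are bilipschitz equivalent. -/
def BilipEquivSets {X Y : Type*} [MetricSpace X] [MetricSpace Y] (A : Set X) (B : Set Y) :
    Prop :=
  ∃ (f : X → Y) (L : ℝ), 1 ≤ L ∧ Set.BijOn f A B ∧
    ∀ x₁ ∈ A, ∀ x₂ ∈ A,
      dist x₁ x₂ / L ≤ dist (f x₁) (f x₂) ∧ dist (f x₁) (f x₂) ≤ L * dist x₁ x₂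

/-- `A` and `B` are quasi-Lipschitz equivalent. -/
def QuasiLipEquiv {X Y : Type*} [MetricSpace X] [MetricSpace Y] (A : Set X) (B : Set Y) : Prop :=
  ∃ f : X → Y, Set.BijOn f A B ∧
    ∀ ε : ℝ, 0 < ε → ∃ δ : ℝ, 0 < δ ∧ ∀ x₁ ∈ A, ∀ x₂ ∈ A,
      0 < dist x₁ x₂ → dist x₁ x₂ < δ →
      |Real.log (dist (f x₁) (f x₂)) / Real.log (dist x₁ x₂) - 1| < ε

/-- Ahlfors–David `s`-regular set. -/
def IsADRegular {X : Type*} [MetricSpace X] [MeasurableSpace X] (A : Set X) (s : ℝ) : Prop :=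
  IsCompact A ∧ 0 < Metric.diam A ∧
    ∃ (μ : Measure X) (c : ℝ), 1 ≤ c ∧ μ Aᶜ = 0 ∧
      ∀ x ∈ A, ∀ r : ℝ, 0 < r → r ≤ Metric.diam A →
        ENNReal.ofReal (c⁻¹ * r ^ s) ≤ μ (Metric.closedBall x r) ∧
          μ (Metric.closedBall x r) ≤ ENNReal.ofReal (c * r ^ s)

/-- `n₁ ⋯ n_k` (with `0`-based indexing of the sequence `n`). -/
def prodN (n : ℕ → ℕ) (k : ℕ) : ℕ := ∏ i ∈ Finset.range k, n i

/-- `c₁ ⋯ c_k` (with `0`-based indexing of the sequence `c`). -/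
def prodC (c : ℕ → ℝ) (k : ℕ) : ℝ := ∏ i ∈ Finset.range k, c i

/-- Admissible word for the branching sequence `n`. -/
def AdmWord (n : ℕ → ℕ) (w : List ℕ) : Prop := ∀ i : Fin w.length, w.get i < n i.val

/-- A Moran structure on `J ⊆ ℝ^d` with branching numbers `n` and ratios `c`:
`Jw w` is the basic set indexed by the word `w`. -/
structure IsMoranSystem {d : ℕ} (J : Set (EuclideanSpace ℝ (Fin d))) (n : ℕ → ℕ)
    (c : ℕ → ℝ) (Jw : List ℕ → Set (EuclideanSpace ℝ (Fin d))) : Prop where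
  compact : IsCompact J
  int_nonempty : (interior J).Nonempty
  two_le_n : ∀ k, 2 ≤ n k
  c_pos : ∀ k, 0 < c k
  c_lt_one : ∀ k, c k < 1
  c_inf_pos : ∃ c₀ : ℝ, 0 < c₀ ∧ ∀ k, c₀ ≤ c k
  root : Jw [] = J
  subset : ∀ w : List ℕ, AdmWord n w → ∀ i : ℕ, i < n w.length → Jw (w ++ [i]) ⊆ Jw w
  similar : ∀ w : List ℕ, AdmWord n w → ∀ i : ℕ, i < n w.length →
    ∃ S : EuclideanSpace ℝ (Fin d) → EuclideanSpace ℝ (Fin d),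
      (∀ x y, dist (S x) (S y) = c w.length * dist x y) ∧ Jw (w ++ [i]) = S '' Jw w
  disj_int : ∀ w : List ℕ, AdmWord n w → ∀ i : ℕ, i < n w.length → ∀ j : ℕ, j < n w.length →
    i ≠ j → Disjoint (interior (Jw (w ++ [i]))) (interior (Jw (w ++ [j])))

/-- The Moran set determined by the family `Jw`. -/
def moranSet {d : ℕ} (n : ℕ → ℕ) (Jw : List ℕ → Set (EuclideanSpace ℝ (Fin d))) :
    Set (EuclideanSpace ℝ (Fin d)) :=
  ⋂ k : ℕ, ⋃ (w : List ℕ) (_ : w.length = k ∧ AdmWord n w), Jw w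

/-- The index `k` such that `(c₁⋯c_k)·D < r ≤ (c₁⋯c_{k-1})·D`. -/
def levelOf (c : ℕ → ℝ) (D r : ℝ) : ℕ := sInf {k : ℕ | prodC c k * D < r}

/-- `Φ(r) = n₁⋯n_k` whenever `(c₁⋯c_k)·D < r ≤ (c₁⋯c_{k-1})·D`, where `D = |J|`. -/
def Phi (n : ℕ → ℕ) (c : ℕ → ℝ) (D r : ℝ) : ℕ := prodN n (levelOf c D r)

namespace IsHomog

variable {X : Type*} [MetricSpace X] [MeasurableSpace X] {A : Set X} {μ : Measure X}
  {lam kappa del Del : ℝ}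

lemma real_closedBall_pos (h : IsHomog A μ lam kappa del Del) {x : X} (hx : x ∈ A) {r : ℝ}
    (hr : 0 < r) : 0 < μ.real (Metric.closedBall x r) := by
  have := h.prob
  exact ENNReal.toReal_pos (h.supp_pos x hx r hr).ne' (measure_ne_top _ _)

lemma real_closedBall_mono (h : IsHomog A μ lam kappa del Del) (x : X) {r s : ℝ} (hrs : r ≤ s) :
    μ.real (Metric.closedBall x r) ≤ μ.real (Metric.closedBall x s) := by
  have := h.prob
  exact measureReal_mono (Metric.closedBall_subset_closedBall hrs)

lemma pow_mul_real_closedBall_le (h : IsHomog A μ lam kappa del Del) {x : X} (hx : x ∈ A) {r : ℝ}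
    (hr : 0 < r) (hr' : r ≤ Metric.diam A) (j : ℕ) :
    del ^ j * μ.real (Metric.closedBall x (kappa ^ j * r)) ≤ μ.real (Metric.closedBall x r) := by
  induction j with
  | zero => simp
  | succ j ih =>
    have hk := h.kappa_pos
    have h1 : kappa ^ j * r ≤ Metric.diam A :=
      (mul_le_of_le_one_left hr.le (pow_le_one₀ hk.le h.kappa_lt_one.le)).trans hr'
    have h2 := h.scale_lower x hx (kappa ^ j * r) (by positivity) h1
    have h3 : 0 ≤ del ^ j := pow_nonneg (by linarith [h.one_lt_del]) j
    calc del ^ (j + 1) * μ.real (Metric.closedBall x (kappa ^ (j + 1) * r))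
        = del ^ j * (del * μ.real (Metric.closedBall x (kappa * (kappa ^ j * r)))) := by
          rw [show kappa * (kappa ^ j * r) = kappa ^ (j + 1) * r by ring]; ring
      _ ≤ del ^ j * μ.real (Metric.closedBall x (kappa ^ j * r)) := by gcongr; exact h2
      _ ≤ _ := ih

lemma real_closedBall_le_pow_mul (h : IsHomog A μ lam kappa del Del) {x : X} (hx : x ∈ A) {r : ℝ}
    (hr : 0 < r) (hr' : r ≤ Metric.diam A) (j : ℕ) :
    μ.real (Metric.closedBall x r) ≤ Del ^ j * μ.real (Metric.closedBall x (kappa ^ j * r)) := by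
  induction j with
  | zero => simp
  | succ j ih =>
    have hk := h.kappa_pos
    have h1 : kappa ^ j * r ≤ Metric.diam A :=
      (mul_le_of_le_one_left hr.le (pow_le_one₀ hk.le h.kappa_lt_one.le)).trans hr'
    have h2 := h.scale_upper x hx (kappa ^ j * r) (by positivity) h1
    have h3 : 0 ≤ Del ^ j := pow_nonneg (by linarith [h.one_lt_del, h.del_le_Del]) j
    calc μ.real (Metric.closedBall x r)
        ≤ Del ^ j * μ.real (Metric.closedBall x (kappa ^ j * r)) := ih
      _ ≤ Del ^ j * (Del * μ.real (Metric.closedBall x (kappa * (kappa ^ j * r)))) := by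
          gcongr; exact h2
      _ = _ := by rw [show kappa * (kappa ^ j * r) = kappa ^ (j + 1) * r by ring]; ring

/-- Ball masses shrink by an arbitrarily large factor when the radius is scaled down enough. -/
lemma exists_shrink (h : IsHomog A μ lam kappa del Del) (T : ℝ) :
    ∃ q₀ : ℝ, 0 < q₀ ∧ ∀ q : ℝ, q ≤ q₀ → ∀ x ∈ A, ∀ r : ℝ, 0 < r → r ≤ Metric.diam A →
      T * μ.real (Metric.closedBall x (q * r)) ≤ μ.real (Metric.closedBall x r) := by
  obtain ⟨j, hj⟩ := pow_unbounded_of_one_lt T h.one_lt_del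
  refine ⟨kappa ^ j, pow_pos h.kappa_pos j, fun q hq x hx r hr hr' => ?_⟩
  have hd : 0 ≤ del ^ j := pow_nonneg (by linarith [h.one_lt_del]) j
  calc T * μ.real (Metric.closedBall x (q * r))
      ≤ del ^ j * μ.real (Metric.closedBall x (kappa ^ j * r)) := by
        refine mul_le_mul hj.le (h.real_closedBall_mono x ?_) measureReal_nonneg hd
        gcongr
    _ ≤ _ := h.pow_mul_real_closedBall_le hx hr hr' j

/-- Ball masses are doubling. -/
lemma exists_doubling (h : IsHomog A μ lam kappa del Del) {q : ℝ} (hq : 0 < q) :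
    ∃ M : ℝ, 1 ≤ M ∧ ∀ x ∈ A, ∀ r : ℝ, 0 < r → r ≤ Metric.diam A →
      μ.real (Metric.closedBall x r) ≤ M * μ.real (Metric.closedBall x (q * r)) := by
  obtain ⟨j, hj⟩ := exists_pow_lt_of_lt_one hq h.kappa_lt_one
  have hD : 1 ≤ Del := by linarith [h.one_lt_del, h.del_le_Del]
  refine ⟨Del ^ j, one_le_pow₀ hD, fun x hx r hr hr' => ?_⟩
  refine (h.real_closedBall_le_pow_mul hx hr hr' j).trans ?_
  exact mul_le_mul_of_nonneg_left (h.real_closedBall_mono x (by gcongr)) (by positivity)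

/-- A ball of radius `R` contains as many `s`-separated points as its mass allows. -/
lemma exists_separated [OpensMeasurableSpace X] (h : IsHomog A μ lam kappa del Del) {x₀ x : X}
    (hx₀ : x₀ ∈ A) {s R : ℝ} (hs : 0 < s) (hs' : s ≤ Metric.diam A) {m : ℕ}
    (hm : m * (lam * μ.real (Metric.closedBall x₀ s)) ≤ μ.real (Metric.closedBall x R)) :
    ∃ p : Fin m → X, (∀ i, p i ∈ A ∧ dist (p i) x ≤ R) ∧
      Pairwise fun i j => s ≤ dist (p i) (p j) := by
  classical
  have := h.prob
  have hφ := h.real_closedBall_pos hx₀ hs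
  have hlam : 0 < lam := by linarith [h.one_le_lam]
  have key : ∀ k ≤ m, ∃ F : Finset X, F.card = k ∧ (∀ y ∈ F, y ∈ A ∧ dist y x ≤ R) ∧
      ∀ y ∈ F, ∀ z ∈ F, y ≠ z → s ≤ dist y z := by
    intro k hk
    induction k with
    | zero => exact ⟨∅, by simp⟩
    | succ k ih =>
      obtain ⟨F, hF, hFA, hFs⟩ := ih (by omega)
      have hlt : μ.real (⋃ y ∈ F, Metric.closedBall y s) < μ.real (Metric.closedBall x R) := by
        calc μ.real (⋃ y ∈ F, Metric.closedBall y s)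
            ≤ ∑ y ∈ F, μ.real (Metric.closedBall y s) := measureReal_biUnion_finset_le _ _
          _ ≤ ∑ y ∈ F, lam * μ.real (Metric.closedBall x₀ s) :=
              Finset.sum_le_sum fun y hy => h.ratio_le y (hFA y hy).1 x₀ hx₀ s hs hs'
          _ = k * (lam * μ.real (Metric.closedBall x₀ s)) := by simp [hF]
          _ < m * (lam * μ.real (Metric.closedBall x₀ s)) := by
              have : (k : ℝ) < m := by exact_mod_cast hk
              gcongr
          _ ≤ _ := hm
      obtain ⟨y, hyA, hyR, hyF⟩ : ∃ y ∈ A, y ∈ Metric.closedBall x R ∧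
          y ∉ ⋃ y ∈ F, Metric.closedBall y s := by
        by_contra! hcon
        have hsub : Metric.closedBall x R ⊆ (⋃ y ∈ F, Metric.closedBall y s) ∪ Aᶜ := by
          intro z hz
          by_cases hzA : z ∈ A
          · exact Or.inl (hcon z hzA hz)
          · exact Or.inr hzA
        have h0 : μ.real Aᶜ = 0 := by simp [measureReal_def, h.supp_null]
        have h1 := (measureReal_mono hsub (measure_ne_top μ _)).trans (measureReal_union_le _ _)
        linarith
      have hyF' : ∀ z ∈ F, s < dist y z := by
        intro z hz
        by_contra! hle
        exact hyF (Set.mem_biUnion hz (Metric.mem_closedBall.2 hle))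
      have hnot : y ∉ F := fun hy => by
        have := hyF' y hy
        rw [dist_self] at this
        linarith
      refine ⟨insert y F, by rw [Finset.card_insert_of_notMem hnot, hF], ?_, ?_⟩
      · intro z hz
        rcases Finset.mem_insert.1 hz with rfl | hz
        · exact ⟨hyA, Metric.mem_closedBall.1 hyR⟩
        · exact hFA z hz
      · intro z hz w hw hzw
        rcases Finset.mem_insert.1 hz with hz' | hz' <;>
          rcases Finset.mem_insert.1 hw with hw' | hw'
        · exact absurd (hz'.trans hw'.symm) hzw
        · rw [hz']; exact (hyF' w hw').le
        · rw [hw', dist_comm]; exact (hyF' z hz').le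
        · exact hFs z hz' w hw' hzw
  obtain ⟨F, hF, hFA, hFs⟩ := key m le_rfl
  let e : Fin m ≃ F := (F.equivFinOfCardEq hF).symm
  exact ⟨fun i => e i, fun i => hFA _ (e i).2, fun i j hij => hFs _ (e i).2 _ (e j).2
    fun heq => hij (e.injective (Subtype.ext heq))⟩

end IsHomog

/-- `f` maps the sequence space `∏ Fin (n k)` into `X` so that two sequences that first differ at
index `k` have images at distance comparable to `S * q ^ k`. -/
structure IsCantorMap {X : Type*} [MetricSpace X] {n : ℕ → ℕ} (f : (∀ k, Fin (n k)) → X)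
    (S q E : ℝ) : Prop where
  dist_le : ∀ σ τ : ∀ k, Fin (n k), ∀ k, (∀ i < k, σ i = τ i) → dist (f σ) (f τ) ≤ E * (S * q ^ k)
  le_dist : ∀ σ τ : ∀ k, Fin (n k), ∀ k, (∃ i ≤ k, σ i ≠ τ i) → S * q ^ k / 2 ≤ dist (f σ) (f τ)

lemma exists_isCantorMap {X : Type*} [MetricSpace X] {A : Set X} (hA : IsCompact A) {n : ℕ → ℕ}
    {S q : ℝ} (hS : 0 < S) (hq : 0 < q) (hq' : q ≤ 1 / 2) (p : Fin (n 0) → X)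
    (hpA : ∀ i, p i ∈ A) (hp : Pairwise fun i j => S ≤ dist (p i) (p j))
    (hstep : ∀ k, ∀ x ∈ A, ∃ c : Fin (n (k + 1)) → X,
      (∀ i, c i ∈ A ∧ dist (c i) x ≤ S * q ^ k / 8) ∧
        Pairwise fun i j => S * q ^ (k + 1) ≤ dist (c i) (c j)) :
    ∃ (f : (∀ k, Fin (n k)) → X) (E : ℝ), 1 ≤ E ∧ (∀ σ, f σ ∈ A) ∧
      (∀ σ, dist (f σ) (p (σ 0)) ≤ S / 4) ∧ IsCantorMap f S q E := by
  choose! c hcA hcs using hstep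
  let P : (∀ k, Fin (n k)) → ℕ → X := fun σ k =>
    Nat.rec (p (σ 0)) (fun k x => c k x (σ (k + 1))) k
  have hP0 : ∀ σ, P σ 0 = p (σ 0) := fun σ => rfl
  have hPs : ∀ σ k, P σ (k + 1) = c k (P σ k) (σ (k + 1)) := fun σ k => rfl
  have hPA : ∀ σ k, P σ k ∈ A := by
    intro σ k
    induction k with
    | zero => exact hpA _
    | succ k ih => exact (hcA k _ ih _).1
  have hdist : ∀ σ k, dist (P σ k) (P σ (k + 1)) ≤ S / 8 * q ^ k := by
    intro σ k
    rw [hPs, dist_comm]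
    refine ((hcA k _ (hPA σ k) _).2).trans (le_of_eq ?_)
    ring
  have hagree : ∀ σ τ k, (∀ i ≤ k, σ i = τ i) → P σ k = P τ k := by
    intro σ τ k hk
    induction k with
    | zero => rw [hP0, hP0, hk 0 le_rfl]
    | succ k ih => rw [hPs, hPs, ih fun i hi => hk i (by omega), hk (k + 1) le_rfl]
  have hq1 : q < 1 := by linarith
  have hlim : ∀ σ, ∃ y ∈ A, Tendsto (P σ) atTop (nhds y) := fun σ =>
    cauchySeq_tendsto_of_isComplete hA.isComplete (hPA σ)
      (cauchySeq_of_le_geometric q (S / 8) hq1 (hdist σ))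
  choose f hfA hf using hlim
  have hfP : ∀ σ k, dist (P σ k) (f σ) ≤ S * q ^ k / 4 := by
    intro σ k
    refine (dist_le_of_le_geometric_of_tendsto q (S / 8) hq1 (hdist σ) (hf σ) k).trans ?_
    rw [div_le_iff₀ (by linarith)]
    have : 0 < S * q ^ k := by positivity
    nlinarith
  refine ⟨f, max 1 (max (1 / (2 * q)) (Metric.diam A / S)), le_max_left _ _, hfA, fun σ => ?_,
    fun σ τ k hk => ?_, fun σ τ k hk => ?_⟩
  · rw [dist_comm]; simpa [hP0] using hfP σ 0
  · rcases k with _ | k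
    · calc dist (f σ) (f τ) ≤ Metric.diam A :=
            Metric.dist_le_diam_of_mem hA.isBounded (hfA σ) (hfA τ)
        _ = Metric.diam A / S * (S * q ^ 0) := by field_simp
        _ ≤ _ := by
          gcongr
          exact (le_max_right _ _).trans (le_max_right _ _)
    · have hPeq := hagree σ τ k fun i hi => hk i (by omega)
      calc dist (f σ) (f τ) ≤ dist (f σ) (P σ k) + dist (P σ k) (f τ) := dist_triangle _ _ _
        _ ≤ S * q ^ k / 4 + S * q ^ k / 4 := by
          refine add_le_add ?_ ?_
          · rw [dist_comm]; exact hfP σ k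
          · rw [hPeq]; exact hfP τ k
        _ = 1 / (2 * q) * (S * q ^ (k + 1)) := by field_simp; ring
        _ ≤ _ := by
          gcongr
          exact (le_max_left _ _).trans (le_max_right _ _)
  · classical
    have hex : ∃ i, σ i ≠ τ i := hk.imp fun i hi => hi.2
    set i := Nat.find hex with hi
    have hne : σ i ≠ τ i := Nat.find_spec hex
    have heq : ∀ j < i, σ j = τ j := fun j hj => not_not.1 (Nat.find_min hex hj)
    have hik : i ≤ k := by
      obtain ⟨j, hj, hj'⟩ := hk
      exact (Nat.find_le (h := hex) hj').trans hj
    have hsep : S * q ^ i ≤ dist (P σ i) (P τ i) := by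
      clear_value i
      rcases i with _ | i
      · rw [hP0, hP0]; simpa using hp hne
      · rw [hPs, hPs, hagree σ τ i fun j hj => heq j (by omega)]
        exact hcs i _ (hPA τ i) hne
    have h1 := hfP σ i
    have h2 := hfP τ i
    have h3 := dist_triangle4 (P σ i) (f σ) (f τ) (P τ i)
    rw [dist_comm (f τ)] at h3
    have h4 : S * q ^ k ≤ S * q ^ i := by
      exact mul_le_mul_of_nonneg_left (pow_le_pow_of_le_one hq.le hq1.le hik) hS.le
    linarith

namespace IsCantorMap

variable {X Y : Type*} [MetricSpace X] [MetricSpace Y] {n : ℕ → ℕ} {f : (∀ k, Fin (n k)) → X}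
  {g : (∀ k, Fin (n k)) → Y} {S q E E' : ℝ}

lemma exists_dist_mem (hf : IsCantorMap f S q E) (hg : IsCantorMap g S q E')
    {σ τ : ∀ k, Fin (n k)} (hne : σ ≠ τ) :
    ∃ k, (S * q ^ k / 2 ≤ dist (f σ) (f τ) ∧ dist (f σ) (f τ) ≤ E * (S * q ^ k)) ∧
      S * q ^ k / 2 ≤ dist (g σ) (g τ) ∧ dist (g σ) (g τ) ≤ E' * (S * q ^ k) := by
  classical
  have hex : ∃ i, σ i ≠ τ i := Function.ne_iff.1 hne
  have heq : ∀ j < Nat.find hex, σ j = τ j := fun j hj => not_not.1 (Nat.find_min hex hj)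
  have hk : ∃ i ≤ Nat.find hex, σ i ≠ τ i := ⟨_, le_rfl, Nat.find_spec hex⟩
  exact ⟨Nat.find hex, ⟨hf.le_dist _ _ _ hk, hf.dist_le _ _ _ heq⟩, hg.le_dist _ _ _ hk,
    hg.dist_le _ _ _ heq⟩

lemma injective (hf : IsCantorMap f S q E) (hS : 0 < S) (hq : 0 < q) : Function.Injective f := by
  intro σ τ h
  by_contra hne
  obtain ⟨k, ⟨hk, -⟩, -⟩ := hf.exists_dist_mem hf hne
  rw [h, dist_self] at hk
  have : 0 < S * q ^ k := by positivity
  linarith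

lemma continuous (hf : IsCantorMap f S q E) (hq : 0 < q) (hq' : q < 1) : Continuous f := by
  rw [continuous_iff_continuousAt]
  intro σ
  rw [ContinuousAt, Metric.tendsto_nhds]
  intro ε hε
  have hlim : Tendsto (fun k => E * (S * q ^ k)) atTop (nhds 0) := by
    simpa using ((tendsto_pow_atTop_nhds_zero_of_lt_one hq.le hq').const_mul S).const_mul E
  obtain ⟨k, hk⟩ := (hlim.eventually (gt_mem_nhds hε)).exists
  have hopen : IsOpen {τ : ∀ k, Fin (n k) | ∀ i < k, τ i = σ i} := by
    have : {τ : ∀ k, Fin (n k) | ∀ i < k, τ i = σ i} = (Set.Iio k).pi fun i => {σ i} := by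
      ext τ; simp [Set.mem_pi]
    rw [this]
    exact isOpen_set_pi (Set.finite_Iio k) fun i _ => isOpen_discrete _
  filter_upwards [hopen.mem_nhds (show σ ∈ {τ : ∀ k, Fin (n k) | ∀ i < k, τ i = σ i} by simp)]
    with τ hτ
  exact (hf.dist_le τ σ k hτ).trans_lt hk

lemma bilipEmbed_range [Nonempty (∀ k, Fin (n k))] (hf : IsCantorMap f S q E)
    (hg : IsCantorMap g S q E') (hS : 0 < S) (hq : 0 < q) (hE : 1 ≤ E) (hE' : 1 ≤ E') {B : Set Y}
    (hB : ∀ σ, g σ ∈ B) : BilipEmbed (Set.range f) B := by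
  have hinv : ∀ σ, Function.invFun f (f σ) = σ :=
    Function.leftInverse_invFun (hf.injective hS hq)
  refine ⟨g ∘ Function.invFun f, 2 * E * E', by nlinarith, ?_, ?_, ?_⟩
  · intro x _
    exact hB _
  · rintro _ ⟨σ, rfl⟩ _ ⟨τ, rfl⟩ h
    simp only [Function.comp_apply, hinv] at h
    rw [hg.injective hS hq h]
  · rintro _ ⟨σ, rfl⟩ _ ⟨τ, rfl⟩
    simp only [Function.comp_apply, hinv]
    by_cases hne : σ = τ
    · simp [hne]
    obtain ⟨k, ⟨h1, h2⟩, h3, h4⟩ := hf.exists_dist_mem hg hne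
    have hpos : 0 < S * q ^ k := by positivity
    constructor
    · rw [div_le_iff₀ (by positivity)]
      nlinarith [mul_le_mul_of_nonneg_right h3 (show 0 ≤ 2 * E by positivity),
        mul_le_mul_of_nonneg_left hE' (show 0 ≤ dist (g σ) (g τ) * (2 * E) by positivity)]
    · nlinarith [mul_le_mul_of_nonneg_left h1 (show 0 ≤ 2 * E' by positivity),
        mul_le_mul_of_nonneg_left hE (show 0 ≤ dist (f σ) (f τ) * (2 * E') by positivity)]

end IsCantorMap

lemma exists_two_mul_pow_lt_one {q E : ℝ} (hE : 0 < E) (hq : 0 < q) (hq' : q < 1) :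
    ∃ m : ℕ, 2 * E * q ^ (m + 1) < 1 := by
  obtain ⟨m, hm⟩ := exists_pow_lt_of_lt_one (show (0 : ℝ) < 1 / (2 * E) by positivity) hq'
  refine ⟨m, ?_⟩
  rw [lt_div_iff₀ (by positivity)] at hm
  have : q ^ (m + 1) ≤ q ^ m := pow_le_pow_of_le_one hq.le hq'.le (by omega)
  nlinarith

lemma prodN_succ (n : ℕ → ℕ) (k : ℕ) : prodN n (k + 1) = prodN n k * n k :=
  Finset.prod_range_succ n k

lemma prodN_pos (n : ℕ → ℕ) [∀ k, NeZero (n k)] (k : ℕ) : 0 < prodN n k :=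
  Finset.prod_pos fun i _ => Nat.pos_of_ne_zero (NeZero.ne (n i))

lemma prodN_add_le {n : ℕ → ℕ} {M : ℝ} (hM : ∀ k, (n k : ℝ) ≤ M) (k j : ℕ) :
    (prodN n (k + j) : ℝ) ≤ M ^ j * prodN n k := by
  have hM0 : 0 ≤ M := (Nat.cast_nonneg _).trans (hM 0)
  induction j with
  | zero => simp
  | succ j ih =>
    rw [← add_assoc, prodN_succ, Nat.cast_mul]
    calc (prodN n (k + j) : ℝ) * n (k + j) ≤ (M ^ j * prodN n k) * M :=
          mul_le_mul ih (hM _) (Nat.cast_nonneg _) (by positivity)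
      _ = _ := by ring

/-- The uniform probability measure on the sequence space `∏ Fin (n k)`. -/
def uniformSeq (n : ℕ → ℕ) [∀ k, NeZero (n k)] : Measure (∀ k, Fin (n k)) :=
  Measure.infinitePi fun k => (PMF.uniformOfFintype (Fin (n k))).toMeasure

instance (n : ℕ → ℕ) [∀ k, NeZero (n k)] : IsProbabilityMeasure (uniformSeq n) := by
  unfold uniformSeq; infer_instance

lemma uniformSeq_real_cylinder (n : ℕ → ℕ) [∀ k, NeZero (n k)] (σ : ∀ k, Fin (n k)) (k : ℕ) :
    (uniformSeq n).real {τ | ∀ i < k, τ i = σ i} = (prodN n k : ℝ)⁻¹ := by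
  have : {τ : ∀ k, Fin (n k) | ∀ i < k, τ i = σ i} =
      Set.pi (Finset.range k) fun i => {σ i} := by
    ext τ; simp [Set.mem_pi]
  rw [this, measureReal_def, uniformSeq,
    Measure.infinitePi_pi _ fun i _ => measurableSet_singleton _, ENNReal.toReal_prod]
  simp [prodN]

namespace IsCantorMap

variable {X : Type*} [MetricSpace X] [MeasurableSpace X] [BorelSpace X] {n : ℕ → ℕ}
  [∀ k, NeZero (n k)] {f : (∀ k, Fin (n k)) → X} {S q E : ℝ}

lemma isProbabilityMeasure_map (hf : IsCantorMap f S q E) (hq : 0 < q) (hq' : q < 1) :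
    IsProbabilityMeasure ((uniformSeq n).map f) :=
  Measure.isProbabilityMeasure_map (hf.continuous hq hq').measurable.aemeasurable

lemma map_real_closedBall (hf : IsCantorMap f S q E) (hq : 0 < q) (hq' : q < 1) (x : X) (r : ℝ) :
    ((uniformSeq n).map f).real (Metric.closedBall x r) =
      (uniformSeq n).real (f ⁻¹' Metric.closedBall x r) :=
  map_measureReal_apply (hf.continuous hq hq').measurable Metric.isClosed_closedBall.measurableSet

lemma inv_prodN_le (hf : IsCantorMap f S q E) (hq : 0 < q) (hq' : q < 1) (σ : ∀ k, Fin (n k))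
    {k : ℕ} {r : ℝ} (hr : E * (S * q ^ k) ≤ r) :
    (prodN n k : ℝ)⁻¹ ≤ ((uniformSeq n).map f).real (Metric.closedBall (f σ) r) := by
  rw [hf.map_real_closedBall hq hq', ← uniformSeq_real_cylinder n σ k]
  exact measureReal_mono fun τ hτ => (hf.dist_le τ σ k hτ).trans hr

lemma le_inv_prodN_succ (hf : IsCantorMap f S q E) (hq : 0 < q) (hq' : q < 1)
    (σ : ∀ k, Fin (n k)) {k : ℕ} {r : ℝ} (hr : r < S * q ^ k / 2) :
    ((uniformSeq n).map f).real (Metric.closedBall (f σ) r) ≤ (prodN n (k + 1) : ℝ)⁻¹ := by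
  rw [hf.map_real_closedBall hq hq', ← uniformSeq_real_cylinder n σ (k + 1)]
  refine measureReal_mono fun τ hτ i hi => ?_
  by_contra hne
  have := (hf.le_dist τ σ k ⟨i, by omega, hne⟩).trans hτ
  linarith

lemma le_inv_prodN (hf : IsCantorMap f S q E) (hS : 0 < S) (hq : 0 < q) (hq' : q < 1)
    (σ : ∀ k, Fin (n k)) {m : ℕ} (hm : 2 * E * q ^ (m + 1) < 1) {k : ℕ} {r : ℝ}
    (hr : r ≤ E * (S * q ^ k)) :
    ((uniformSeq n).map f).real (Metric.closedBall (f σ) r) ≤ (prodN n (k - m) : ℝ)⁻¹ := by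
  have := hf.isProbabilityMeasure_map hq hq'
  rcases Nat.eq_zero_or_pos (k - m) with h0 | h0
  · rw [h0]
    simp [prodN]
  · obtain ⟨j, rfl⟩ : ∃ j, k = m + 1 + j := ⟨k - m - 1, by omega⟩
    rw [show m + 1 + j - m = j + 1 by omega]
    refine hf.le_inv_prodN_succ hq hq' σ (hr.trans_lt ?_)
    have : 0 < S * q ^ j := by positivity
    rw [show E * (S * q ^ (m + 1 + j)) = (2 * E * q ^ (m + 1)) * (S * q ^ j) / 2 by ring]
    nlinarith

lemma exists_scale (hS : 0 < S) (hE : 0 < E) (hq : 0 < q) (hq' : q < 1) {r : ℝ} (hr : 0 < r)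
    (hr' : r ≤ E * S) : ∃ k, E * (S * q ^ (k + 1)) < r ∧ r ≤ E * (S * q ^ k) := by
  obtain ⟨k, hk, hk'⟩ := exists_nat_pow_near_of_lt_one (x := r / (E * S)) (by positivity)
    ((div_le_one (by positivity)).2 hr') hq hq'
  rw [lt_div_iff₀ (by positivity)] at hk
  rw [div_le_iff₀ (by positivity)] at hk'
  exact ⟨k, by linarith, by linarith⟩

lemma exists_isHomog_range (hf : IsCantorMap f S q E) (hS : 0 < S) (hE : 1 ≤ E) (hq : 0 < q)
    (hq' : q < 1) (hn : ∀ k, 2 ≤ n (k + 1)) {M : ℝ} (hM : ∀ k, (n k : ℝ) ≤ M) :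
    ∃ lam kappa del Del : ℝ,
      IsHomog (Set.range f) ((uniformSeq n).map f) lam kappa del Del := by
  have hcont := hf.continuous hq hq'
  have hprob := hf.isProbabilityMeasure_map hq hq'
  have hE0 : 0 < E := by linarith
  have hM2 : 2 ≤ M := le_trans (by exact_mod_cast hn 0) (hM 1)
  have hcomp : IsCompact (Set.range f) := isCompact_range hcont
  have hN : ∀ k, (0 : ℝ) < prodN n k := fun k => by exact_mod_cast prodN_pos n k
  obtain ⟨m, hm⟩ := exists_two_mul_pow_lt_one hE0 hq hq'
  have hdiam : Metric.diam (Set.range f) ≤ E * S := by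
    refine Metric.diam_le_of_forall_dist_le (by positivity) ?_
    rintro _ ⟨σ, rfl⟩ _ ⟨τ, rfl⟩
    simpa using hf.dist_le σ τ 0 (by simp)
  have hdiam_pos : 0 < Metric.diam (Set.range f) := by
    have h2 : 2 ≤ n 1 := hn 0
    let σ : ∀ k, Fin (n k) := fun k => 0
    let τ : ∀ k, Fin (n k) := Function.update σ 1 ⟨1, by omega⟩
    have hne : σ 1 ≠ τ 1 := by
      simp only [σ, τ, Function.update_self]
      intro h
      have := congrArg Fin.val h
      simp at this
    have h := hf.le_dist σ τ 1 ⟨1, le_rfl, hne⟩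
    have h' := Metric.dist_le_diam_of_mem hcomp.isBounded ⟨σ, rfl⟩ ⟨τ, rfl⟩
    have : 0 < S * q ^ 1 := by positivity
    linarith
  have hscale : ∀ r, 0 < r → r ≤ Metric.diam (Set.range f) →
      ∃ k, E * (S * q ^ (k + 1)) < r ∧ r ≤ E * (S * q ^ k) := fun r hr hr' =>
    exists_scale hS hE0 hq hq' hr (hr'.trans hdiam)
  have hcomp_prod : ∀ k j a, a ≤ k + j → (prodN n (k - m) : ℝ)⁻¹ ≤
      M ^ (m + j) * (prodN n a : ℝ)⁻¹ := by
    intro k j a ha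
    have hMM : (1 : ℝ) ≤ M := by linarith
    have h1 : (prodN n a : ℝ) ≤ M ^ (m + j) * prodN n (k - m) := by
      rcases le_total a (k - m) with h | h
      · obtain ⟨d, hd⟩ := Nat.exists_eq_add_of_le h
        have : prodN n a ≤ prodN n (k - m) :=
          Finset.prod_le_prod_of_subset_of_one_le' (Finset.range_subset_range.2 h)
            fun i _ _ => Nat.pos_of_ne_zero (NeZero.ne (n i))
        calc (prodN n a : ℝ) ≤ prodN n (k - m) := by exact_mod_cast this
          _ ≤ _ := le_mul_of_one_le_left (hN _).le (one_le_pow₀ hMM)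
      · obtain ⟨d, rfl⟩ := Nat.exists_eq_add_of_le h
        refine (prodN_add_le hM (k - m) d).trans ?_
        exact mul_le_mul_of_nonneg_right (pow_le_pow_right₀ hMM (by omega)) (hN _).le
    rw [← div_eq_mul_inv, le_div_iff₀ (hN _), inv_mul_le_iff₀ (hN _)]
    linarith
  have hq2 : 0 < q ^ (m + 2) := by positivity
  refine ⟨M ^ (m + 1), q ^ (m + 2), 2, M ^ (m + (m + 3)), hcomp, hdiam_pos, hprob, ?_, ?_,
    one_le_pow₀ (by linarith), ?_, hq2, pow_lt_one₀ hq.le hq' (by omega), by norm_num, ?_, ?_, ?_⟩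
  · rw [Measure.map_apply hcont.measurable hcomp.isClosed.measurableSet.compl]
    have : f ⁻¹' (Set.range f)ᶜ = ∅ := by
      ext τ; simp
    rw [this, measure_empty]
  · rintro _ ⟨σ, rfl⟩ r hr
    obtain ⟨k, hk⟩ := exists_pow_lt_of_lt_one (show 0 < r / (E * S) by positivity) hq'
    rw [lt_div_iff₀ (by positivity)] at hk
    have h := hf.inv_prodN_le hq hq' σ (k := k) (r := r) (by linarith)
    exact (ENNReal.toReal_pos_iff.1 ((inv_pos.2 (hN k)).trans_le h)).1
  · rintro _ ⟨σ, rfl⟩ _ ⟨τ, rfl⟩ r hr hr'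
    obtain ⟨k, hk, hk'⟩ := hscale r hr hr'
    refine (hf.le_inv_prodN hS hq hq' σ hm hk').trans ((hcomp_prod k 1 (k + 1) le_rfl).trans ?_)
    exact mul_le_mul_of_nonneg_left (hf.inv_prodN_le hq hq' τ hk.le) (by positivity)
  · refine hM2.trans (le_self_pow₀ (by linarith) (by omega))
  · rintro _ ⟨σ, rfl⟩ r hr hr'
    obtain ⟨k, hk, hk'⟩ := hscale r hr hr'
    have h1 := hf.inv_prodN_le hq hq' σ hk.le
    have h2 := hf.le_inv_prodN hS hq hq' σ hm (k := k + (m + 2)) (r := q ^ (m + 2) * r) (by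
      calc q ^ (m + 2) * r ≤ q ^ (m + 2) * (E * (S * q ^ k)) := by gcongr
        _ = _ := by ring)
    rw [show k + (m + 2) - m = k + 1 + 1 by omega, prodN_succ] at h2
    have h3 : ((prodN n (k + 1) * n (k + 1) : ℕ) : ℝ)⁻¹ ≤ (prodN n (k + 1) : ℝ)⁻¹ / 2 := by
      rw [Nat.cast_mul, mul_inv, div_eq_mul_inv]
      have : (2 : ℝ) ≤ n (k + 1) := by exact_mod_cast hn k
      have := hN (k + 1)
      gcongr
    change 2 * Measure.real _ _ ≤ Measure.real _ _
    linarith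
  · rintro _ ⟨σ, rfl⟩ r hr hr'
    obtain ⟨k, hk, hk'⟩ := hscale r hr hr'
    refine (hf.le_inv_prodN hS hq hq' σ hm hk').trans
      ((hcomp_prod k (m + 3) (k + (m + 3)) le_rfl).trans ?_)
    refine mul_le_mul_of_nonneg_left (hf.inv_prodN_le hq hq' σ ?_) (by positivity)
    calc E * (S * q ^ (k + (m + 3))) = q ^ (m + 2) * (E * (S * q ^ (k + 1))) := by ring
      _ ≤ _ := by gcongr

end IsCantorMap

namespace IsHomog

variable {X Y : Type*} [MetricSpace X] [MeasurableSpace X] [MetricSpace Y] [MeasurableSpace Y]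
  {A : Set X} {B : Set Y} {μ : Measure X} {ν : Measure Y}
  {lam kappa del Del lam' kappa' del' Del' : ℝ}

/-- Every ball of radius `r / 8` contains `m` points that are `s`-separated, provided `m` is at
most a fixed fraction of the ratio of the masses of balls of radii `r` and `s`. -/
lemma exists_separated_of_le [OpensMeasurableSpace X] (h : IsHomog A μ lam kappa del Del) {x : X}
    (hx : x ∈ A) :
    ∃ c : ℝ, 0 < c ∧ c ≤ 1 ∧ ∀ z ∈ A, ∀ r s : ℝ, 0 < r → r ≤ Metric.diam A → 0 < s →
      s ≤ Metric.diam A → ∀ m : ℕ,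
      m * μ.real (Metric.closedBall x s) ≤ c * μ.real (Metric.closedBall x r) →
      ∃ p : Fin m → X, (∀ i, p i ∈ A ∧ dist (p i) z ≤ r / 8) ∧
        Pairwise fun i j => s ≤ dist (p i) (p j) := by
  obtain ⟨M, hM, hdoub⟩ := h.exists_doubling (q := 1 / 8) (by norm_num)
  have hl := h.one_le_lam
  have hl2 : 1 ≤ lam * (lam * M) := by nlinarith [mul_le_mul hl hM (by norm_num) (by linarith)]
  refine ⟨1 / (lam * (lam * M)), by positivity, by rw [div_le_one (by linarith)]; exact hl2,
    fun z hz r s hr hr' hs hs' m hm => h.exists_separated hx hs hs' ?_⟩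
  have h1 := hdoub x hx r hr hr'
  have h2 : μ.real (Metric.closedBall x (r / 8)) ≤ lam * μ.real (Metric.closedBall z (r / 8)) :=
    h.ratio_le x hx z hz (r / 8) (by positivity) (by linarith)
  rw [show 1 / 8 * r = r / 8 by ring] at h1
  have h3 : M * μ.real (Metric.closedBall x (r / 8)) ≤
      M * (lam * μ.real (Metric.closedBall z (r / 8))) :=
    mul_le_mul_of_nonneg_left h2 (by linarith)
  calc m * (lam * μ.real (Metric.closedBall x s))
      = lam * (m * μ.real (Metric.closedBall x s)) := by ring
    _ ≤ lam * (1 / (lam * (lam * M)) * (M * (lam * μ.real (Metric.closedBall z (r / 8))))) := by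
        refine mul_le_mul_of_nonneg_left (hm.trans ?_) (by linarith)
        exact mul_le_mul_of_nonneg_left (h1.trans h3) (by positivity)
    _ = _ := by field_simp

/-- The mass of a ball tends to zero with its radius. -/
lemma tendsto_real_closedBall (h : IsHomog A μ lam kappa del Del) {x : X} (hx : x ∈ A) :
    Tendsto (fun r => μ.real (Metric.closedBall x r)) (nhdsWithin 0 (Set.Ioi 0)) (nhds 0) := by
  have := h.prob
  rw [Metric.tendsto_nhds]
  intro ε hε
  obtain ⟨q, hq, hshrink⟩ := h.exists_shrink (2 / ε)
  have hd := h.diam_pos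
  filter_upwards [Ioo_mem_nhdsGT (show 0 < q * Metric.diam A by positivity)] with r hr
  have h1 := hshrink q le_rfl x hx _ hd le_rfl
  have h2 : μ.real (Metric.closedBall x (Metric.diam A)) ≤ 1 := measureReal_le_one
  have h3 := h.real_closedBall_mono x hr.2.le
  have h4 : μ.real (Metric.closedBall x (q * Metric.diam A)) ≤ ε / 2 := by
    have h5 := h1.trans h2
    rw [div_mul_eq_mul_div, div_le_one hε] at h5
    linarith
  rw [Real.dist_eq, sub_zero, abs_of_nonneg measureReal_nonneg]
  linarith

end IsHomog

lemma IsAlphaRep.exists_abs_sub_le {X : Type*} [MetricSpace X] [MeasurableSpace X] {A : Set X}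
    {μ : Measure X} {g : ℝ → ℝ} (hg : IsAlphaRep A μ g) :
    ∃ x ∈ A, ∃ C : ℝ, 0 < C ∧ ∃ δ : ℝ, 0 < δ ∧ ∀ r : ℝ, 0 < r → r < δ →
      |Real.log (μ.real (Metric.closedBall x r)) - g r * Real.log r| ≤ C := by
  obtain ⟨x, hx, C, hC, δ, hδ, h⟩ := hg
  refine ⟨x, hx, C, hC, min δ 1, by positivity, fun r hr hr' => ?_⟩
  have hlog : Real.log r < 0 := Real.log_neg hr (hr'.trans_le (min_le_right _ _))
  have h1 := h r hr (hr'.trans_le (min_le_left _ _))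
  dsimp only [alphaPt] at h1
  rwa [le_div_iff₀ (abs_pos.2 hlog.ne), ← abs_mul, sub_mul, div_mul_cancel₀ _ hlog.ne] at h1

/-- The ratio condition on the local dimensions makes mass ratios in `A` smaller than those in `B`
by an arbitrarily large factor, over sufficiently small scale ratios. -/
lemma IsHomog.exists_log_sub_add_le {X Y : Type*} [MetricSpace X] [MeasurableSpace X]
    [MetricSpace Y] [MeasurableSpace Y] {B : Set Y} {μ : Measure X} {ν : Measure Y}
    {lam kappa del Del : ℝ} (hB : IsHomog B ν lam kappa del Del) {x : X} {y : Y} (hy : y ∈ B)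
    {u v : ℝ → ℝ} {C C' δ : ℝ} (hδ : 0 < δ)
    (hu : ∀ r, 0 < r → r < δ → |Real.log (μ.real (Metric.closedBall x r)) - u r| ≤ C)
    (hv : ∀ r, 0 < r → r < δ → |Real.log (ν.real (Metric.closedBall y r)) - v r| ≤ C')
    {r₀ b : ℝ} (hr₀ : 0 < r₀) (hr₀' : r₀ < 1) (hb : b < 1)
    (h : ∀ r r' : ℝ, 0 < r' → r' < r₀ * r → r < r₀ → |(u r - u r') / (v r - v r')| ≤ b) (K : ℝ) :
    ∃ q₀ : ℝ, 0 < q₀ ∧ ∃ R : ℝ, 0 < R ∧ ∀ q, 0 < q → q ≤ q₀ → ∀ r, 0 < r → r < R →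
      Real.log (μ.real (Metric.closedBall x r)) - Real.log (μ.real (Metric.closedBall x (q * r))) +
        K ≤ Real.log (ν.real (Metric.closedBall y r)) -
          Real.log (ν.real (Metric.closedBall y (q * r))) := by
  have hb0 : 0 ≤ b := (abs_nonneg _).trans
    (h (r₀ / 2) (r₀ * (r₀ / 4)) (by positivity) (by nlinarith) (by linarith))
  set T := max ((2 * C + 2 * C' * b + K) / (1 - b)) (2 * C' + 1) with hT
  obtain ⟨q₁, hq₁, hshrink⟩ := hB.exists_shrink (Real.exp T)
  refine ⟨min q₁ (r₀ / 2), by positivity, min (min δ r₀) (Metric.diam B),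
    lt_min (lt_min hδ hr₀) hB.diam_pos, fun q hq hq' r hr hr' => ?_⟩
  have hrδ : r < δ := hr'.trans_le ((min_le_left _ _).trans (min_le_left _ _))
  have hrr₀ : r < r₀ := hr'.trans_le ((min_le_left _ _).trans (min_le_right _ _))
  have hrd : r ≤ Metric.diam B := hr'.le.trans (min_le_right _ _)
  have hqr : 0 < q * r := by positivity
  have hq2 : q ≤ r₀ / 2 := hq'.trans (min_le_right _ _)
  have hqr' : q * r < r₀ * r := by nlinarith
  have hqrδ : q * r < δ := by nlinarith
  have hL : T + Real.log (ν.real (Metric.closedBall y (q * r))) ≤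
      Real.log (ν.real (Metric.closedBall y r)) := by
    have hpos := hB.real_closedBall_pos hy hqr
    have := Real.log_le_log (by positivity)
      (hshrink q (hq'.trans (min_le_left _ _)) y hy r hr hrd)
    rwa [Real.log_mul (Real.exp_pos _).ne' hpos.ne', Real.log_exp] at this
  obtain ⟨hu1, hu2⟩ := abs_le.1 (hu r hr hrδ)
  obtain ⟨hu3, hu4⟩ := abs_le.1 (hu _ hqr hqrδ)
  obtain ⟨hv1, hv2⟩ := abs_le.1 (hv r hr hrδ)
  obtain ⟨hv3, hv4⟩ := abs_le.1 (hv _ hqr hqrδ)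
  have hT1 : 2 * C' + 1 ≤ T := le_max_right _ _
  have hT2 : 2 * C + 2 * C' * b + K ≤ T * (1 - b) := by
    rw [← div_le_iff₀ (by linarith)]; exact le_max_left _ _
  have hvpos : 0 < v r - v (q * r) := by linarith
  have hmain := (le_abs_self _).trans (h r (q * r) hqr hqr' hrr₀)
  rw [div_le_iff₀ hvpos] at hmain
  have hlast : b * (v r - v (q * r)) ≤ b * (Real.log (ν.real (Metric.closedBall y r)) -
      Real.log (ν.real (Metric.closedBall y (q * r))) + 2 * C') :=
    mul_le_mul_of_nonneg_left (by linarith) hb0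
  nlinarith [mul_le_mul_of_nonneg_right (show T ≤ Real.log (ν.real (Metric.closedBall y r)) -
      Real.log (ν.real (Metric.closedBall y (q * r))) by linarith) (show 0 ≤ 1 - b by linarith)]

lemma chiFun_lt_of_eventually {g' g : ℝ → ℝ} {ε η C : ℝ} (hε : 0 < ε)
    (hη : η = (1 - Real.exp (-(ε / 2))) / 2)
    (hg : Tendsto (fun r => -(g r * Real.log r)) (nhdsWithin 0 (Set.Ioi 0)) atTop)
    (hle : ∀ᶠ r in nhdsWithin (0 : ℝ) (Set.Ioi 0),
      (1 - η) * -(g r * Real.log r) - C ≤ -(g' r * Real.log r) ∧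
        -(g' r * Real.log r) ≤ -(g r * Real.log r) + C) :
    chiFun g' g < ε := by
  have hη0 : 0 < η := by
    have : Real.exp (-(ε / 2)) < 1 := by simpa using hε
    linarith
  have hηε : η ≤ ε / 2 := by
    have := Real.add_one_le_exp (-(ε / 2))
    linarith
  have hηe : 1 - 2 * η = Real.exp (-(ε / 2)) := by linarith
  refine lt_of_le_of_lt (b := ε / 2) ?_ (by linarith)
  refine limsup_le_of_le
    (isBoundedUnder_of ⟨0, fun r => abs_nonneg _⟩ :
      IsBoundedUnder (· ≥ ·) _ _).isCoboundedUnder_le ?_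
  filter_upwards [hle, hg.eventually_ge_atTop (C / η), hg.eventually_gt_atTop 0,
    Ioo_mem_nhdsGT (zero_lt_one' ℝ)] with r hr hr1 hr2 hr3
  have hlog : Real.log r < 0 := Real.log_neg hr3.1 hr3.2
  set w := -(g r * Real.log r) with hw
  set a := -(g' r * Real.log r) with ha
  have hdiv : g' r / g r = a / w := by
    rw [hw, ha, neg_div_neg_eq, mul_div_mul_right _ _ hlog.ne]
  rw [div_le_iff₀ hη0] at hr1
  have h1 : Real.exp (-(ε / 2)) ≤ a / w := by
    rw [le_div_iff₀ hr2, ← hηe]; nlinarith [hr.1]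
  have h2 : a / w ≤ 1 + η := by
    rw [div_le_iff₀ hr2]; nlinarith [hr.2]
  have hpos : 0 < a / w := (Real.exp_pos _).trans_le h1
  rw [hdiv, abs_le]
  refine ⟨(Real.le_log_iff_exp_le hpos).2 h1, ?_⟩
  have := Real.log_le_sub_one_of_pos hpos
  linarith

/-- If the branching numbers of a Cantor map follow the increments of `log φ` up to a factor
`1 - η`, then the logarithmic ball masses of its image follow `log φ` up to the same factor. -/
lemma IsCantorMap.exists_eventually_log_mass {X : Type*} [MetricSpace X] [MeasurableSpace X]
    [BorelSpace X] {n : ℕ → ℕ} [∀ k, NeZero (n k)] {f : (∀ k, Fin (n k)) → X} {S q E : ℝ}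
    (hf : IsCantorMap f S q E) (hS : 0 < S) (hE : 1 ≤ E) (hq : 0 < q) (hq' : q < 1) {M : ℝ}
    (hM : ∀ k, (n k : ℝ) ≤ M) {φ : ℝ → ℝ} (hφ : Monotone φ) (hφ0 : ∀ r, 0 < r → 0 < φ r)
    (hφ1 : φ S ≤ 1)
    (hdoub : ∀ p, 0 < p → ∃ D : ℝ, 1 ≤ D ∧ ∀ r, 0 < r → r ≤ S → φ r ≤ D * φ (p * r))
    {η : ℝ} (hη : 0 ≤ η) (hη' : η ≤ 1)
    (hn : ∀ k, (1 - η) * (Real.log (φ (S * q ^ k)) - Real.log (φ (S * q ^ (k + 1)))) ≤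
      Real.log (n (k + 1)))
    (hn' : ∀ k, Real.log (n (k + 1)) ≤
      Real.log (φ (S * q ^ k)) - Real.log (φ (S * q ^ (k + 1)))) (σ : ∀ k, Fin (n k)) :
    ∃ C : ℝ, ∀ᶠ r in nhdsWithin (0 : ℝ) (Set.Ioi 0),
      (1 - η) * -Real.log (φ r) - C ≤
          -Real.log (((uniformSeq n).map f).real (Metric.closedBall (f σ) r)) ∧
        -Real.log (((uniformSeq n).map f).real (Metric.closedBall (f σ) r)) ≤
          -Real.log (φ r) + C := by
  have hE0 : 0 < E := by linarith
  have hN : ∀ k, (0 : ℝ) < prodN n k := fun k => by exact_mod_cast prodN_pos n k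
  have hn1 : ∀ k, (1 : ℝ) ≤ n k := fun k => by
    exact_mod_cast Nat.one_le_iff_ne_zero.2 (NeZero.ne (n k))
  have hM1 : 1 ≤ M := (hn1 0).trans (hM 0)
  obtain ⟨m, hm⟩ := exists_two_mul_pow_lt_one hE0 hq hq'
  obtain ⟨D, hD, hdoub⟩ := hdoub (q ^ (m + 2)) (by positivity)
  have hlogS : Real.log (φ S) ≤ 0 := Real.log_nonpos (hφ0 S hS).le hφ1
  have hlogN : ∀ j, (1 - η) * (Real.log (φ S) - Real.log (φ (S * q ^ j))) ≤
      Real.log (prodN n (j + 1)) ∧ Real.log (prodN n (j + 1)) ≤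
        Real.log (n 0) + (Real.log (φ S) - Real.log (φ (S * q ^ j))) := by
    intro j
    induction j with
    | zero => simpa [prodN] using Real.log_nonneg (hn1 0)
    | succ j ih =>
      rw [prodN_succ n (j + 1), Nat.cast_mul,
        Real.log_mul (hN _).ne' (by linarith [hn1 (j + 1)])]
      have h1 := hn j
      have h2 := hn' j
      constructor
      · linarith [ih.1]
      · linarith [ih.2]
  have hlogn : 0 ≤ Real.log (n 0) := Real.log_nonneg (hn1 0)
  have hlogM : 0 ≤ Real.log M := Real.log_nonneg hM1
  have hlogD : 0 ≤ Real.log D := Real.log_nonneg hD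
  refine ⟨Real.log D - Real.log (φ S) + Real.log (n 0) + (m + 1) * Real.log M, ?_⟩
  filter_upwards [Ioo_mem_nhdsGT (show 0 < E * (S * q ^ (m + 1)) by positivity)] with r hr
  obtain ⟨k, hk, hk'⟩ := exists_scale hS hE0 hq hq' hr.1 (hr.2.le.trans (by
    have : q ^ (m + 1) ≤ 1 := pow_le_one₀ hq.le hq'.le
    gcongr
    nlinarith))
  obtain ⟨j, rfl⟩ : ∃ j, k = j + (m + 1) := by
    refine ⟨k - (m + 1), ?_⟩
    by_contra hcon
    have : q ^ (m + 1) ≤ q ^ (k + 1) := pow_le_pow_of_le_one hq.le hq'.le (by omega)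
    have : E * (S * q ^ (m + 1)) ≤ E * (S * q ^ (k + 1)) := by gcongr
    linarith [hr.2]
  have hmass := hf.inv_prodN_le hq hq' σ hk.le
  have hmass' := hf.le_inv_prodN hS hq hq' σ hm hk'
  rw [show j + (m + 1) - m = j + 1 by omega] at hmass'
  have hpos := (inv_pos.2 (hN (j + (m + 1) + 1))).trans_le hmass
  have h1 := Real.log_le_log (inv_pos.2 (hN _)) hmass
  have h2 := Real.log_le_log hpos hmass'
  rw [Real.log_inv] at h1 h2
  have h3 := Real.log_le_log (hN _) (prodN_add_le hM (j + 1) (m + 1))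
  rw [Real.log_mul (by positivity) (hN _).ne', Real.log_pow,
    show j + 1 + (m + 1) = j + (m + 1) + 1 by omega] at h3
  push_cast at h3
  have hSj : 0 < S * q ^ j := by positivity
  have hrj : r ≤ S * q ^ j := by
    refine hk'.trans ?_
    rw [show E * (S * q ^ (j + (m + 1))) = (2 * E * q ^ (m + 1)) * (S * q ^ j) / 2 by ring]
    nlinarith
  have h4 := Real.log_le_log (hφ0 r hr.1) (hφ hrj)
  have h5 : Real.log (φ (S * q ^ j)) ≤ Real.log D + Real.log (φ r) := by
    have hlow : q ^ (m + 2) * (S * q ^ j) ≤ r := by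
      refine le_trans ?_ hk.le
      rw [show E * (S * q ^ (j + (m + 1) + 1)) = E * (q ^ (m + 2) * (S * q ^ j)) by ring]
      exact le_mul_of_one_le_left (by positivity) hE
    have hle := (hdoub _ hSj (mul_le_of_le_one_right hS.le (pow_le_one₀ hq.le hq'.le))).trans
      (mul_le_mul_of_nonneg_left (hφ hlow) (by linarith))
    rw [← Real.log_mul (by linarith) (hφ0 r hr.1).ne']
    exact Real.log_le_log (hφ0 _ hSj) hle
  obtain ⟨h6, h7⟩ := hlogN j
  have hml : 0 ≤ (m + 1) * Real.log M := by positivity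
  constructor
  · have h8 : (1 - η) * (Real.log (φ S) - (Real.log D + Real.log (φ r))) ≤
        (1 - η) * (Real.log (φ S) - Real.log (φ (S * q ^ j))) :=
      mul_le_mul_of_nonneg_left (by linarith) (by linarith)
    nlinarith [mul_nonneg hη hlogD, mul_nonneg hη (neg_nonneg.2 hlogS)]
  · linarith

/-- Embedding theorem, first part: if
`sup_{r' < r₀ r < r < r₀} |(α_A(r)log r − α_A(r')log r')/(α_B(r)log r − α_B(r')log r')| < 1`
for some `r₀ < 1`, then for every `ε > 0` there is a homogeneous subset `A_ε ⊆ A` with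
`d_H(A_ε,A) < ε`, `χ(A_ε,A) < ε`, which can be bilipschitz embedded into `B`. -/
theorem statement14 {X Y : Type*} [MetricSpace X] [MeasurableSpace X] [BorelSpace X]
    [MetricSpace Y] [MeasurableSpace Y] [BorelSpace Y]
    (A : Set X) (B : Set Y) (μ : Measure X) (ν : Measure Y)
    (lamA kapA delA DelA lamB kapB delB DelB : ℝ)
    (hA : IsHomog A μ lamA kapA delA DelA) (hB : IsHomog B ν lamB kapB delB DelB)
    (gA gB : ℝ → ℝ) (hgA : IsAlphaRep A μ gA) (hgB : IsAlphaRep B ν gB)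
    (hsup : ∃ r₀ : ℝ, 0 < r₀ ∧ r₀ < 1 ∧ ∃ b : ℝ, b < 1 ∧
      ∀ r r' : ℝ, 0 < r' → r' < r₀ * r → r < r₀ →
        |(gA r * Real.log r - gA r' * Real.log r') /
          (gB r * Real.log r - gB r' * Real.log r')| ≤ b) :
    ∀ ε : ℝ, 0 < ε → ∃ Aε : Set X, Aε ⊆ A ∧
      (∃ (μ' : Measure X) (lam' kappa' del' Del' : ℝ),
        IsHomog Aε μ' lam' kappa' del' Del' ∧
        ∃ g' : ℝ → ℝ, IsAlphaRep Aε μ' g' ∧ chiFun g' gA < ε) ∧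
      Metric.hausdorffDist Aε A < ε ∧ BilipEmbed Aε B := by
  intro ε hε
  obtain ⟨x, hx, C, hC, δ, hδ, hu⟩ := hgA.exists_abs_sub_le
  obtain ⟨y, hy, C', -, δ', hδ', hv⟩ := hgB.exists_abs_sub_le
  obtain ⟨r₀, hr₀, hr₀', b, hb, hratio⟩ := hsup
  have hprobA := hA.prob
  have hdA := hA.diam_pos
  have hdB := hB.diam_pos
  set φ : ℝ → ℝ := fun r => μ.real (Metric.closedBall x r) with hφ
  set ψ : ℝ → ℝ := fun r => ν.real (Metric.closedBall y r) with hψ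
  have hφ0 : ∀ r, 0 < r → 0 < φ r := fun r hr => hA.real_closedBall_pos hx hr
  have hψ0 : ∀ r, 0 < r → 0 < ψ r := fun r hr => hB.real_closedBall_pos hy hr
  obtain ⟨c, hc, hc1, hsepA⟩ := hA.exists_separated_of_le hx
  obtain ⟨c', hc', hc1', hsepB⟩ := hB.exists_separated_of_le hy
  obtain ⟨η, hη⟩ : ∃ η, η = (1 - Real.exp (-(ε / 2))) / 2 := ⟨_, rfl⟩
  have hη0 : 0 < η := by
    have : Real.exp (-(ε / 2)) < 1 := by simpa using hε
    linarith
  have hη1 : η < 1 := by linarith [Real.exp_pos (-(ε / 2))]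
  obtain ⟨q₁, hq₁, R, hR, hcomp⟩ := hB.exists_log_sub_add_le (x := x) hy (lt_min hδ hδ')
    (fun r hr hr' => hu r hr (hr'.trans_le (min_le_left _ _)))
    (fun r hr hr' => hv r hr (hr'.trans_le (min_le_right _ _))) hr₀ hr₀' hb hratio
    (-Real.log c')
  have hlogc : 0 < Real.log (2 / c) := Real.log_pos (by rw [lt_div_iff₀ hc]; linarith)
  obtain ⟨q₂, hq₂, hshrink⟩ := hA.exists_shrink (Real.exp (Real.log (2 / c) / η))
  obtain ⟨q, hq, hqq₁, hqq₂, hq2⟩ : ∃ q, 0 < q ∧ q ≤ q₁ ∧ q ≤ q₂ ∧ q ≤ 1 / 2 :=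
    ⟨min q₁ (min q₂ (1 / 2)), by positivity, min_le_left _ _,
      (min_le_right _ _).trans (min_le_left _ _), (min_le_right _ _).trans (min_le_right _ _)⟩
  have hq1 : q < 1 := by linarith
  obtain ⟨F, hFA, hFfin, hFcov⟩ := hA.compact.finite_cover_balls (show 0 < ε / 3 by positivity)
  lift F to Finset X using hFfin
  have hFpos : 0 < F.card := by
    obtain ⟨z, hz, -⟩ := Set.mem_iUnion₂.1 (hFcov hx)
    exact Finset.card_pos.2 ⟨z, hz⟩
  obtain ⟨S, hS, hSdA, hSdB, hSR, hSε, hSF, hSψ⟩ : ∃ S, 0 < S ∧ S < Metric.diam A ∧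
      S < Metric.diam B ∧ S < R ∧ S < ε / 3 ∧
      (∀ z ∈ F, ∀ w ∈ F, z ≠ w → S ≤ dist z w) ∧
      F.card * ψ S ≤ c' * ψ (Metric.diam B) := by
    have hsmall : ∀ t : ℝ, 0 < t → ∀ᶠ s in nhdsWithin (0 : ℝ) (Set.Ioi 0), s < t := fun t ht =>
      (eventually_lt_nhds ht).filter_mono nhdsWithin_le_nhds
    have hF : ∀ᶠ s in nhdsWithin (0 : ℝ) (Set.Ioi 0), ∀ z ∈ F, ∀ w ∈ F, z ≠ w → s ≤ dist z w := by
      rw [Filter.eventually_all_finset]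
      intro z hz
      rw [Filter.eventually_all_finset]
      intro w hw
      by_cases hzw : z = w
      · simp [hzw]
      · exact (hsmall _ (dist_pos.2 hzw)).mono fun s hs _ => hs.le
    have hlim := (hB.tendsto_real_closedBall hy).const_mul (F.card : ℝ)
    rw [mul_zero] at hlim
    have hψ' := hlim.eventually_le_const (mul_pos hc' (hψ0 _ hdB))
    obtain ⟨S, hS⟩ := (eventually_mem_nhdsWithin.and ((hsmall _ hdA).and ((hsmall _ hdB).and
      ((hsmall _ hR).and ((hsmall (ε / 3) (by positivity)).and (hF.and hψ')))))).exists
    exact ⟨S, hS⟩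
  have hSk : ∀ k, 0 < S * q ^ k := fun k => by positivity
  have hSk' : ∀ k, S * q ^ k ≤ S := fun k =>
    mul_le_of_le_one_right hS.le (pow_le_one₀ hq.le hq1.le)
  have hSs : ∀ k, S * q ^ (k + 1) = q * (S * q ^ k) := fun k => by ring
  let ρ : ℕ → ℝ := fun k => φ (S * q ^ k) / φ (S * q ^ (k + 1))
  have hρ0 : ∀ k, 0 < ρ k := fun k => div_pos (hφ0 _ (hSk k)) (hφ0 _ (hSk (k + 1)))
  have hlogρ : ∀ k, Real.log (ρ k) =
      Real.log (φ (S * q ^ k)) - Real.log (φ (S * q ^ (k + 1))) := fun k =>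
    Real.log_div (hφ0 _ (hSk k)).ne' (hφ0 _ (hSk (k + 1))).ne'
  have hηρ : ∀ k, Real.log (2 / c) ≤ η * Real.log (ρ k) := by
    intro k
    have h1 := hshrink q hqq₂ x hx (S * q ^ k) (hSk k) ((hSk' k).trans hSdA.le)
    rw [← hSs, ← le_div_iff₀ (hφ0 _ (hSk (k + 1)))] at h1
    have h2 := (Real.le_log_iff_exp_le (hρ0 k)).2 h1
    rw [div_le_iff₀ hη0] at h2
    linarith
  have hcρ : ∀ k, 2 ≤ c * ρ k := by
    intro k
    have h1 : Real.log (2 / c) ≤ Real.log (ρ k) := by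
      have h2 := hηρ k
      by_contra! h3
      nlinarith
    have h2 := (Real.log_le_log_iff (by positivity) (hρ0 k)).1 h1
    rw [div_le_iff₀ hc] at h2
    linarith
  obtain ⟨D, hD, hdoub⟩ := hA.exists_doubling hq
  have hρD : ∀ k, ρ k ≤ D := fun k => by
    rw [div_le_iff₀ (hφ0 _ (hSk (k + 1))), hSs]
    exact hdoub x hx _ (hSk k) ((hSk' k).trans hSdA.le)
  obtain ⟨n, hn0, hns⟩ : ∃ n : ℕ → ℕ, n 0 = F.card ∧ ∀ k, n (k + 1) = ⌊c * ρ k⌋₊ :=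
    ⟨fun k => Nat.casesOn k F.card fun k => ⌊c * ρ k⌋₊, rfl, fun k => rfl⟩
  have hn2 : ∀ k, 2 ≤ n (k + 1) := fun k => by
    rw [hns]; exact Nat.le_floor (by exact_mod_cast hcρ k)
  have hnle : ∀ k, (n (k + 1) : ℝ) ≤ c * ρ k := fun k => by
    rw [hns]; exact Nat.floor_le (by linarith [hcρ k])
  have : ∀ k, NeZero (n k) := fun k => ⟨by
    rcases k with _ | k
    · rw [hn0]; exact hFpos.ne'
    · have := hn2 k
      omega⟩
  have hM : ∀ k, (n k : ℝ) ≤ max (F.card : ℝ) D := by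
    intro k
    rcases k with _ | k
    · rw [hn0]; exact le_max_left _ _
    · refine le_max_of_le_right ((hnle k).trans ?_)
      exact (mul_le_of_le_one_left (hρ0 k).le hc1).trans (hρD k)
  let e : Fin (n 0) ≃ F := (F.equivFinOfCardEq hn0.symm).symm
  obtain ⟨f, E, hE, hfA, hfe, hf⟩ := exists_isCantorMap hA.compact hS hq hq2
    (fun i => (e i : X)) (fun i => hFA (e i).2)
    (fun i j hij => hSF _ (e i).2 _ (e j).2 fun h => hij (e.injective (Subtype.ext h)))
    (fun k z hz => hsepA z hz _ _ (hSk k) ((hSk' k).trans hSdA.le) (hSk (k + 1))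
      ((hSk' _).trans hSdA.le) (n (k + 1)) (by
        have h1 := hnle k
        rwa [← mul_div_assoc, le_div_iff₀ (hφ0 _ (hSk (k + 1)))] at h1))
  obtain ⟨p, hpB, hp⟩ := hsepB y hy _ S hdB le_rfl hS hSdB.le (n 0)
    (by rwa [hn0])
  obtain ⟨g, E', hE', hgB', -, hg⟩ := exists_isCantorMap hB.compact hS hq hq2 p
    (fun i => (hpB i).1) hp
    (fun k z hz => hsepB z hz _ _ (hSk k) ((hSk' k).trans hSdB.le) (hSk (k + 1))
      ((hSk' _).trans hSdB.le) (n (k + 1)) (by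
        have h1 := hcomp q hq hqq₁ (S * q ^ k) (hSk k) ((hSk' k).trans_lt hSR)
        rw [← hSs] at h1
        have h2 : Real.log (ρ k) ≤ Real.log (c' * (ψ (S * q ^ k) / ψ (S * q ^ (k + 1)))) := by
          rw [hlogρ, Real.log_mul hc'.ne'
            (div_pos (hψ0 _ (hSk k)) (hψ0 _ (hSk (k + 1)))).ne',
            Real.log_div (hψ0 _ (hSk k)).ne' (hψ0 _ (hSk (k + 1))).ne']
          linarith
        have h3 := (Real.log_le_log_iff (hρ0 k)
          (mul_pos hc' (div_pos (hψ0 _ (hSk k)) (hψ0 _ (hSk (k + 1)))))).1 h2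
        have h4 := (hnle k).trans ((mul_le_of_le_one_left (hρ0 k).le hc1).trans h3)
        rwa [← mul_div_assoc, le_div_iff₀ (hψ0 _ (hSk (k + 1)))] at h4))
  obtain ⟨lam', kappa', del', Del', hhom⟩ := hf.exists_isHomog_range hS hE hq hq1 hn2 hM
  let σ₀ : ∀ k, Fin (n k) := fun k => 0
  have hnonempty : Nonempty (∀ k, Fin (n k)) := ⟨σ₀⟩
  refine ⟨Set.range f, Set.range_subset_iff.2 hfA, ⟨(uniformSeq n).map f, lam', kappa', del', Del',
    hhom, alphaPt ((uniformSeq n).map f) (f σ₀), ⟨f σ₀, ⟨σ₀, rfl⟩, 1, one_pos, 1, one_pos, ?_⟩, ?_⟩,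
    ?_, hf.bilipEmbed_range hg hS hq hE hE' hgB'⟩
  · intro r _ _
    rw [sub_self, abs_zero]
    positivity
  · obtain ⟨K, hK⟩ := hf.exists_eventually_log_mass hS hE hq hq1 hM (φ := φ)
      (fun r s hrs => hA.real_closedBall_mono x hrs) hφ0 measureReal_le_one
      (fun t ht => by
        obtain ⟨D, hD, h⟩ := hA.exists_doubling ht
        exact ⟨D, hD, fun r hr hr' => h x hx r hr (hr'.trans hSdA.le)⟩)
      hη0.le hη1.le
      (fun k => by
        rw [← hlogρ]
        have h1 : c * ρ k / 2 ≤ n (k + 1) := by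
          have := Nat.lt_floor_add_one (c * ρ k)
          rw [← hns] at this
          linarith [hcρ k]
        have h2 := Real.log_le_log (by linarith [hcρ k]) h1
        rw [show c * ρ k / 2 = ρ k / (2 / c) by field_simp,
          Real.log_div (hρ0 k).ne' (by positivity)] at h2
        linarith [hηρ k])
      (fun k => by
        rw [← hlogρ]
        have : 0 < n (k + 1) := by linarith [hn2 k]
        exact Real.log_le_log (by exact_mod_cast this)
          ((hnle k).trans (mul_le_of_le_one_left (hρ0 k).le hc1)))
      σ₀
    have hlogφ : Tendsto (fun r => Real.log (φ r)) (nhdsWithin 0 (Set.Ioi 0)) atBot := by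
      refine Real.tendsto_log_nhdsGT_zero.comp (tendsto_nhdsWithin_iff.2
        ⟨hA.tendsto_real_closedBall hx, ?_⟩)
      filter_upwards [self_mem_nhdsWithin] with r hr using hφ0 r hr
    have hclose : ∀ᶠ r in nhdsWithin (0 : ℝ) (Set.Ioi 0),
        |Real.log (φ r) - gA r * Real.log r| ≤ C := by
      filter_upwards [Ioo_mem_nhdsGT hδ] with r hr using hu r hr.1 hr.2
    refine chiFun_lt_of_eventually (C := K + C) hε hη ?_ ?_
    · refine tendsto_atTop_mono' _ ?_
        (tendsto_atTop_add_const_right _ (-C) (tendsto_neg_atBot_atTop.comp hlogφ))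
      filter_upwards [hclose] with r hr
      have := (abs_le.1 hr).1
      simp only [Function.comp_apply]
      linarith
    · filter_upwards [hK, hclose, Ioo_mem_nhdsGT (zero_lt_one' ℝ)] with r hr hr' hr1
      have hlog : Real.log r < 0 := Real.log_neg hr1.1 hr1.2
      have hα : alphaPt ((uniformSeq n).map f) (f σ₀) r * Real.log r =
          Real.log (((uniformSeq n).map f).real (Metric.closedBall (f σ₀) r)) :=
        div_mul_cancel₀ _ hlog.ne
      rw [hα]
      obtain ⟨h1, h2⟩ := abs_le.1 hr'
      constructor
      · nlinarith [hr.1]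
      · linarith [hr.2]
  · refine (Metric.hausdorffDist_le_of_mem_dist (r := ε / 3 + S / 4) (by positivity) ?_
      ?_).trans_lt (by linarith)
    · rintro _ ⟨σ, rfl⟩
      exact ⟨f σ, hfA σ, by rw [dist_self]; positivity⟩
    · intro z hz
      obtain ⟨w, hw, hzw⟩ := Set.mem_iUnion₂.1 (hFcov hz)
      let σ : ∀ k, Fin (n k) := Function.update σ₀ 0 (e.symm ⟨w, hw⟩)
      have h1 := hfe σ
      have h2 : (e (σ 0) : X) = w := by simp [σ]
      rw [h2, dist_comm] at h1
      exact ⟨f σ, ⟨σ, rfl⟩, (dist_triangle _ w _).trans (add_le_add (Metric.mem_ball.1 hzw).le h1)⟩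

end
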